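/- (Combinatorial core of the existence of Ritt's second form, proved by contradiction using Hall's Matching Theorem.) Let n ≥ 2 and let A = (a_{i,j}) be an n×n matrix with entries in ℤ ∪ {−∞}. Suppose the chain sum S = a_{1,2} + a_{2,3} + ⋯ + a_{n−1,n} satisfies S ≠ −∞ and S = tdet(Ã_{n,1}), where Ã_{n,1} is the submatrix of A obtained by deleting row n and column 1 (so S is a maximal transversal of Ã_{n,1}). Then there exists i ∈ {1,…,n−1} such that (a_{1,2} + a_{2,3} + ⋯ + a_{i−1,i}) + a_{i,1} + (a_{i+1,i+2} + ⋯ + a_{n−1,n}) = tdet(Ã_{n,i+1}), where Ã_{n,i+1} is the submatrix obtained by deleting row n and column i+1; i.e., this shifted chain sum is a maximal transversal of Ã_{n,i+1}. -/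

import Mathlib

/-- The tropical determinant of a square matrix with entries in `ℤ ∪ {−∞}`:
the maximum over all permutations `ρ` of the transversal `∑ i, A i (ρ i)`. -/
noncomputable def tdet {ι : Type*} [Fintype ι] [DecidableEq ι]
    (A : Matrix ι ι (WithBot ℤ)) : WithBot ℤ :=
  Finset.univ.sup fun ρ : Equiv.Perm ι => ∑ i, A i (ρ i)

open Finset in
/-- A self-map of a finite nonempty type permutes some nonempty set. -/
lemma exists_nonempty_image_eq_self {ι : Type*} [Fintype ι] [Nonempty ι] [DecidableEq ι]
    (f : ι → ι) : ∃ C : Finset ι, C.Nonempty ∧ C.image f = C := by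
  obtain ⟨C, hC, hmin⟩ := exists_min_image
    (univ.filter fun C : Finset ι => C.Nonempty ∧ C.image f ⊆ C) Finset.card
    ⟨univ, by simp [univ_nonempty]⟩
  simp only [mem_filter, mem_univ, true_and] at hC hmin
  exact ⟨C, hC.1, eq_of_subset_of_card_le hC.2
    (hmin _ ⟨hC.1.image f, image_subset_image hC.2⟩)⟩

open Finset in
/-- If every transversal supported on `P` has weight at most `s`, then so does, up to the scalar
`c`, every nonnegative matrix supported on `P` whose row and column sums are all `c`. -/
lemma sum_mul_le_of_forall_transversal_le {ι : Type*} [Fintype ι] [DecidableEq ι]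
    {w M : ι → ι → ℚ} {P : ι → ι → Prop} {s c : ℚ} (hc : 0 < c)
    (hs : ∀ ρ : Equiv.Perm ι, (∀ i, P i (ρ i)) → ∑ i, w i (ρ i) ≤ s)
    (hM : ∀ i j, 0 ≤ M i j) (hrow : ∀ i, ∑ j, M i j = c) (hcol : ∀ j, ∑ i, M i j = c)
    (hP : ∀ i j, M i j ≠ 0 → P i j) :
    ∑ i, ∑ j, M i j * w i j ≤ c * s := by
  have hD : (Matrix.of fun i j => M i j / c) ∈ doublyStochastic ℚ ι := by
    rw [mem_doublyStochastic_iff_sum]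
    refine ⟨fun i j => div_nonneg (hM i j) hc.le, fun i => ?_, fun j => ?_⟩ <;>
      simp [← sum_div, hrow, hcol, hc.ne']
  obtain ⟨v, hv, hv1, hvM⟩ := exists_eq_sum_perm_of_mem_doublyStochastic hD
  have hent : ∀ i j, M i j = c * ∑ ρ, v ρ * if ρ i = j then 1 else 0 := by
    intro i j
    have := congrFun (congrFun hvM i) j
    simp only [Matrix.sum_apply, Matrix.smul_apply, Matrix.of_apply, smul_eq_mul,
      Equiv.Perm.permMatrix, PEquiv.toMatrix_apply, Equiv.toPEquiv_apply,
      Option.mem_def, Option.some.injEq] at this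
    rw [this, mul_div_cancel₀ _ hc.ne']
  have hle : ∀ ρ, v ρ * ∑ i, w i (ρ i) ≤ v ρ * s := by
    intro ρ
    rcases (hv ρ).eq_or_lt with h0 | h0
    · simp [← h0]
    refine mul_le_mul_of_nonneg_left (hs ρ fun i => hP _ _ ?_) h0.le
    rw [hent]
    refine (mul_pos hc (sum_pos' (fun σ _ => mul_nonneg (hv σ) ?_) ⟨ρ, mem_univ _, ?_⟩)).ne'
    · split_ifs <;> simp
    · simpa using h0
  calc ∑ i, ∑ j, M i j * w i j = c * ∑ ρ, v ρ * ∑ i, w i (ρ i) := by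
        simp only [hent, mul_assoc, sum_mul, ← mul_sum]
        congr 1
        simp only [sum_comm (s := univ (α := ι)) (t := univ (α := Equiv.Perm ι)), mul_sum]
        simp
    _ ≤ c * ∑ ρ, v ρ * s := mul_le_mul_of_nonneg_left (sum_le_sum fun ρ _ => hle ρ) hc.le
    _ = c * s := by rw [← sum_mul, hv1, one_mul]

open Finset in
/-- Suppose the diagonal is a maximal transversal among those supported on `P`, and `e` is an
additional column. Each `τ i`, with the entry in column `i` moved to the additional column, is a
transversal avoiding column `i`; it cannot for every `i` beat the diagonal modified in row `i`. -/
lemma exists_shifted_transversal_le {ι : Type*} [Fintype ι] [Nonempty ι] [DecidableEq ι]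
    {w : ι → ι → ℚ} {P : ι → ι → Prop} (hP : ∀ i, P i i)
    (hdiag : ∀ ρ : Equiv.Perm ι, (∀ i, P i (ρ i)) → ∑ i, w i (ρ i) ≤ ∑ i, w i i)
    (e : ι → ℚ) (f : ι → ι) (τ : ι → Equiv.Perm ι) (hτf : ∀ i, τ i (f i) = i)
    (hτP : ∀ i r, r ≠ f i → P r (τ i r)) :
    ∃ i ∈ Set.range f, e (f i) + ∑ r ∈ univ.erase (f i), w r (τ i r) ≤
      e i + ∑ k ∈ univ.erase i, w k k := by
  obtain ⟨C, hC, hfC⟩ := exists_nonempty_image_eq_self f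
  have hinj : Set.InjOn f C := card_image_iff.1 (by rw [hfC])
  have hsum : ∀ g : ι → ℚ, ∑ i ∈ C, g (f i) = ∑ i ∈ C, g i := fun g => by
    rw [← sum_image hinj, hfC]
  by_contra! hlt
  let M : ι → ι → ℚ := fun r j =>
    ∑ i ∈ C, (if r ≠ f i ∧ τ i r = j then 1 else 0) + if r = j then if r ∈ C then 1 else 0 else 0
  have hrow : ∀ r, ∑ j, M r j = #C := by
    intro r
    have h1 : ∀ i, (∑ j, if r ≠ f i ∧ τ i r = j then (1 : ℚ) else 0) =
        1 - if r = f i then 1 else 0 := by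
      intro i; by_cases h : r = f i <;> simp [h]
    have h2 := hsum fun i => if r = i then 1 else 0
    simp only [M, sum_add_distrib]
    rw [sum_comm]
    simp only [h1, sum_sub_distrib, h2]
    simp
  have hcol : ∀ j, ∑ r, M r j = #C := by
    intro j
    have h1 : ∀ i, (∑ r, if r ≠ f i ∧ τ i r = j then (1 : ℚ) else 0) =
        1 - if j = i then 1 else 0 := by
      intro i
      have : ∀ r, (r ≠ f i ∧ τ i r = j) ↔ ((τ i).symm j = r ∧ j ≠ i) := by
        intro r
        rw [Equiv.symm_apply_eq, eq_comm (a := j), and_comm]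
        refine and_congr_right fun h => not_congr ?_
        rw [← h, ← (τ i).injective.eq_iff, hτf]
      simp only [this]
      by_cases h : j = i <;> simp [h]
    simp only [M, sum_add_distrib]
    rw [sum_comm]
    simp only [h1, sum_sub_distrib]
    simp
  have hle := sum_mul_le_of_forall_transversal_le (M := M) (c := #C) (by simpa using hC.card_pos)
    hdiag
    (fun i j => add_nonneg (sum_nonneg fun _ _ => by split_ifs <;> simp) (by split_ifs <;> simp))
    hrow hcol fun r j hrj => by
      by_contra hPrj
      refine hrj ?_
      simp only [M]
      rw [sum_eq_zero, if_neg, add_zero]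
      · rintro rfl; exact hPrj (hP r)
      · intro i _
        rw [if_neg]
        rintro ⟨h, rfl⟩; exact hPrj (hτP i r h)
  have hL : ∑ r, ∑ j, M r j * w r j =
      ∑ i ∈ C, ∑ r ∈ univ.erase (f i), w r (τ i r) + ∑ i ∈ C, w i i := by
    simp only [M, add_mul, sum_add_distrib, sum_mul]
    congr 1
    · simp only [sum_comm (s := univ) (t := C)]
      refine sum_congr rfl fun i _ => ?_
      rw [← filter_ne', sum_filter]
      refine sum_congr rfl fun r _ => ?_
      by_cases h : r = f i <;> simp [h]
    · simp
  have hlt' := sum_lt_sum_of_nonempty hC fun i hi =>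
    hlt i (by obtain ⟨k, -, hk⟩ := mem_image.1 (hfC.symm ▸ hi); exact ⟨k, hk⟩)
  have herase : ∀ i, ∑ k ∈ univ.erase i, w k k = ∑ k, w k k - w i i := fun i => by
    rw [← sum_erase_add _ _ (mem_univ i)]; ring
  simp only [sum_add_distrib, hsum, herase, sum_sub_distrib, sum_const, nsmul_eq_mul] at hlt'
  linarith

open Finset in
lemma WithBot.coe_sum_unbotD {ι : Type*} {s : Finset ι} {g : ι → WithBot ℤ}
    (hg : ∀ i ∈ s, g i ≠ ⊥) : ((∑ i ∈ s, (g i).unbotD 0 : ℤ) : WithBot ℤ) = ∑ i ∈ s, g i := by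
  rw [WithBot.coe_sum]
  refine sum_congr rfl fun i hi => ?_
  obtain ⟨z, hz⟩ := WithBot.ne_bot_iff_exists.1 (hg i hi)
  simp [← hz]

open Finset in
lemma sum_le_tdet {ι : Type*} [Fintype ι] [DecidableEq ι] (A : Matrix ι ι (WithBot ℤ))
    (ρ : Equiv.Perm ι) : ∑ i, A i (ρ i) ≤ tdet A :=
  le_sup (f := fun ρ : Equiv.Perm ι => ∑ i, A i (ρ i)) (mem_univ ρ)

open Finset in
lemma exists_sum_eq_tdet {ι : Type*} [Fintype ι] [DecidableEq ι] (A : Matrix ι ι (WithBot ℤ)) :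
    ∃ ρ : Equiv.Perm ι, ∑ i, A i (ρ i) = tdet A := by
  obtain ⟨ρ, -, h⟩ := exists_mem_eq_sup univ univ_nonempty
    fun ρ : Equiv.Perm ι => ∑ i, A i (ρ i)
  exact ⟨ρ, h.symm⟩

/-- A bijection from the rows to the columns other than `i + 1` amounts to a permutation `τ` sending
the row matched with column `0` to `i`. -/
lemma exists_perm_succ_eq_succAbove {n : ℕ} (i : Fin (n + 1)) (σ : Equiv.Perm (Fin (n + 1))) :
    ∃ τ : Equiv.Perm (Fin (n + 1)), τ (σ.symm 0) = i ∧
      ∀ r ≠ σ.symm 0, (τ r).succ = i.succ.succAbove (σ r) := by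
  have hne : ∀ r ≠ σ.symm 0, i.succ.succAbove (σ r) ≠ 0 := fun r hr h =>
    hr ((Equiv.eq_symm_apply σ).2 (Fin.succAbove_right_injective
      (h.trans (Fin.succ_succAbove_zero i).symm)))
  let t : Fin (n + 1) → Fin (n + 1) := fun r =>
    if h : r = σ.symm 0 then i else (i.succ.succAbove (σ r)).pred (hne r h)
  have ht0 : t (σ.symm 0) = i := dif_pos rfl
  have ht : ∀ r ≠ σ.symm 0, (t r).succ = i.succ.succAbove (σ r) := fun r hr => by
    simp [t, hr]
  have htne : ∀ r ≠ σ.symm 0, t r ≠ i := fun r hr h =>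
    Fin.succAbove_ne i.succ (σ r) (by rw [← ht r hr, h])
  have hinj : Function.Injective t := by
    intro r s hrs
    by_cases hr : r = σ.symm 0 <;> by_cases hs : s = σ.symm 0
    · rw [hr, hs]
    · exact absurd (by rw [← hrs, hr, ht0]) (htne s hs)
    · exact absurd (by rw [hrs, hs, ht0]) (htne r hr)
    · exact σ.injective (Fin.succAbove_right_injective (by rw [← ht r hr, ← ht s hs, hrs]))
  exact ⟨Equiv.ofBijective t (Finite.injective_iff_bijective.1 hinj), ht0, ht⟩

open Finset in
/-- The shifted chain sum is a transversal of the matrix with column `i + 1` deleted. -/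
lemma shifted_sum_le_tdet {n : ℕ} (A : Matrix (Fin (n + 2)) (Fin (n + 2)) (WithBot ℤ))
    (i : Fin (n + 1)) :
    A i.castSucc 0 + ∑ k ∈ univ.erase i, A k.castSucc k.succ ≤
      tdet (Matrix.of fun r j : Fin (n + 1) => A r.castSucc (i.succ.succAbove j)) := by
  let g : Fin (n + 1) → Fin (n + 2) := fun r => if r = i then 0 else r.succ
  have hg : ∀ r, ∃ j, i.succ.succAbove j = g r := fun r =>
    Fin.exists_succAbove_eq (by by_cases h : r = i <;> simp [g, h, (Fin.succ_ne_zero _).symm])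
  choose ρ hρ using hg
  have hinj : Function.Injective ρ := by
    intro r s hrs
    have : g r = g s := by rw [← hρ, ← hρ, hrs]
    by_cases hr : r = i <;> by_cases hs : s = i <;>
      simp_all [g, (Fin.succ_ne_zero _).symm]
  refine le_of_eq_of_le ?_
    (sum_le_tdet _ (Equiv.ofBijective ρ (Finite.injective_iff_bijective.1 hinj)))
  rw [← add_sum_erase _ _ (mem_univ i)]
  simp only [Matrix.of_apply, Equiv.ofBijective_apply, hρ, g, if_true]
  congr 1
  exact sum_congr rfl fun k hk => by rw [if_neg (ne_of_mem_erase hk)]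

/-- **Combinatorial core of the existence of Ritt's second form** (proved via Hall's
Matching Theorem).  Indices are `0`-based and the matrix has size `n + 2 ≥ 2`.
The chain sum `S = a_{1,2} + a_{2,3} + ⋯ + a_{n−1,n}` is `∑ i, A i.castSucc i.succ`.
The submatrix `Ã_{n,1}` (delete last row and first column) is
`fun i j => A i.castSucc j.succ`, and `Ã_{n,i+1}` (delete last row and column `i+1`)
is `fun r j => A r.castSucc ((i.succ).succAbove j)`.  If `S ≠ −∞` and `S` is a maximal
transversal of `Ã_{n,1}`, then for some `i` the shifted chain sum, obtained by replacing
the term `a_{i,i+1}` with `a_{i,1}`, is a maximal transversal of `Ã_{n,i+1}`. -/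
theorem ritt_second_form_combinatorial_core (n : ℕ)
    (A : Matrix (Fin (n + 2)) (Fin (n + 2)) (WithBot ℤ))
    (hS : (∑ i : Fin (n + 1), A i.castSucc i.succ) ≠ ⊥)
    (hmax : (∑ i : Fin (n + 1), A i.castSucc i.succ) =
      tdet (Matrix.of fun i j : Fin (n + 1) => A i.castSucc j.succ)) :
    ∃ i : Fin (n + 1),
      A i.castSucc 0 + ∑ k ∈ Finset.univ.erase i, A k.castSucc k.succ =
        tdet (Matrix.of fun r j : Fin (n + 1) => A r.castSucc ((i.succ).succAbove j)) := by
  by_contra! hne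
  have hlt := fun i => (shifted_sum_le_tdet A i).lt_of_ne (hne i)
  choose σ hσ using fun i : Fin (n + 1) => exists_sum_eq_tdet
    (Matrix.of fun r j : Fin (n + 1) => A r.castSucc (i.succ.succAbove j))
  choose τ hτ₀ hτ using fun i => exists_perm_succ_eq_succAbove i (σ i)
  let f : Fin (n + 1) → Fin (n + 1) := fun i => (σ i).symm 0
  have hfin : ∀ i r : Fin (n + 1), A r.castSucc (i.succ.succAbove (σ i r)) ≠ ⊥ := by
    intro i r h
    refine (bot_le.trans_lt (hlt i)).ne' ?_
    rw [← hσ i]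
    exact WithBot.sum_eq_bot_iff.2 ⟨r, Finset.mem_univ r, h⟩
  have hdiag : ∀ i : Fin (n + 1), A i.castSucc i.succ ≠ ⊥ := fun i h =>
    hS (WithBot.sum_eq_bot_iff.2 ⟨i, Finset.mem_univ i, h⟩)
  have hzero : ∀ i : Fin (n + 1), A (f i).castSucc 0 ≠ ⊥ := fun i => by
    simpa [f] using hfin i (f i)
  have hτfin : ∀ i, ∀ r ≠ f i, A r.castSucc (τ i r).succ ≠ ⊥ := fun i r hr => by
    rw [hτ i r hr]; exact hfin i r
  obtain ⟨_, ⟨k, rfl⟩, hle⟩ := exists_shifted_transversal_le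
    (w := fun r j => ((A r.castSucc j.succ).unbotD 0 : ℤ))
    (P := fun r j => A r.castSucc j.succ ≠ ⊥) hdiag (fun ρ hρ => by
      have h := sum_le_tdet (Matrix.of fun i j : Fin (n + 1) => A i.castSucc j.succ) ρ
      simp only [Matrix.of_apply] at h
      rw [← hmax, ← WithBot.coe_sum_unbotD fun i _ => hρ i,
        ← WithBot.coe_sum_unbotD fun i _ => hdiag i, WithBot.coe_le_coe] at h
      exact_mod_cast h)
    (fun i => ((A i.castSucc 0).unbotD 0 : ℤ)) f τ hτ₀ hτfin
  refine (hlt (f k)).not_ge ?_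
  rw [← hσ, ← Finset.add_sum_erase _ _ (Finset.mem_univ (f (f k)))]
  simp only [Matrix.of_apply]
  rw [show σ (f k) (f (f k)) = 0 from (σ (f k)).apply_symm_apply 0, Fin.succ_succAbove_zero,
    Finset.sum_congr rfl fun r hr => by rw [← hτ (f k) r (Finset.ne_of_mem_erase hr)],
    ← WithBot.coe_sum_unbotD fun r hr => hτfin _ r (Finset.ne_of_mem_erase hr),
    ← WithBot.coe_sum_unbotD fun i _ => hdiag i]
  obtain ⟨x, hx⟩ := WithBot.ne_bot_iff_exists.1 (hzero k)
  obtain ⟨y, hy⟩ := WithBot.ne_bot_iff_exists.1 (hzero (f k))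
  rw [← hx, ← hy, WithBot.unbotD_coe, WithBot.unbotD_coe] at hle
  rw [← hx, ← hy]
  exact_mod_cast hle
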